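/- arXiv:1706.08224 — 2 statements merged into one kernel-verified Lean document; each statement's English description precedes it below -/
import Mathlib

section
/- Let P be a probability distribution on a countable set Ω, let N > 0 and 0 < ρ ≤ 1, and suppose every point x in the support of P satisfies P(x) ≥ ρ/N. Let X_1, …, X_M be i.i.d. samples from P with (M−1)·ρ ≤ N. Then the probability that there is at least one collision among the M samples is at least 1 − ∏_{t=1}^{M−1} (1 − tρ/N). -/
open MeasureTheory in
lemma step_bound {Ω : Type*} [Countable Ω] [MeasurableSpace Ω] [MeasurableSingletonClass Ω]
    (P : PMF Ω) (r : ℝ) (hr : 0 ≤ r)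
    (hatom : ∀ x ∈ P.support, r ≤ (P x).toReal) (m : ℕ) (y : Fin m → Ω)
    (hy : ∀ i, y i ∈ P.support) (hinj : Function.Injective y) :
    P.toMeasure {a | ∀ i, a ≠ y i} ≤ ENNReal.ofReal (1 - m * r) := by
  classical
  have hset : {a | ∀ i, a ≠ y i} = (↑(Finset.univ.image y) : Set Ω)ᶜ := by
    ext a
    simp [eq_comm]
  have hmeas : ENNReal.ofReal (m * r) ≤ P.toMeasure (↑(Finset.univ.image y) : Set Ω) := by
    rw [PMF.toMeasure_apply_finset, Finset.sum_image (fun a _ b _ h => hinj h)]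
    calc ENNReal.ofReal (m * r) = ∑ i : Fin m, ENNReal.ofReal r := by
          simp [ENNReal.ofReal_mul]
      _ ≤ _ := Finset.sum_le_sum fun i _ =>
          ENNReal.ofReal_le_of_le_toReal (hatom _ (hy i))
  rw [hset, prob_compl_eq_one_sub (Set.to_countable _).measurableSet,
    ENNReal.ofReal_sub _ (by positivity), ENNReal.ofReal_one]
  exact tsub_le_tsub_left hmeas _

open MeasureTheory in
lemma inj_bound {Ω : Type*} [Countable Ω] [MeasurableSpace Ω] [MeasurableSingletonClass Ω]
    (P : PMF Ω) (r : ℝ) (hr : 0 ≤ r)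
    (hatom : ∀ x ∈ P.support, r ≤ (P x).toReal) (m : ℕ) :
    (Measure.pi fun _ : Fin m => P.toMeasure) {x | Function.Injective x} ≤
      ∏ t ∈ Finset.range m, ENNReal.ofReal (1 - (t : ℝ) * r) := by
  induction m with
  | zero => simpa using prob_le_one
  | succ m ih =>
    have hmp := measurePreserving_piFinSuccAbove (fun _ : Fin (m + 1) => P.toMeasure) 0
    have hpre : {x : Fin (m + 1) → Ω | Function.Injective x} =
        (MeasurableEquiv.piFinSuccAbove (fun _ : Fin (m + 1) => Ω) 0) ⁻¹'
          {p : Ω × (Fin m → Ω) | (∀ i, p.1 ≠ p.2 i) ∧ Function.Injective p.2} := by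
      ext x
      obtain ⟨a, y, rfl⟩ : ∃ a y, x = Fin.cons a y := ⟨x 0, Fin.tail x, by simp⟩
      simp only [Set.mem_setOf_eq, Set.mem_preimage, Fin.cons_injective_iff]
      simp [MeasurableEquiv.piFinSuccAbove, Fin.insertNthEquiv, Fin.removeNth, eq_comm]
    rw [hpre, hmp.measure_preimage_equiv, Measure.prod_apply_symm (Set.to_countable _).measurableSet,
      Finset.prod_range_succ]
    have hsupp : ∀ᵐ a ∂P.toMeasure, a ∈ P.support := by
      rw [ae_iff]
      rw [PMF.toMeasure_apply_eq_zero_iff _ (Set.to_countable _).measurableSet]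
      exact Set.disjoint_left.mpr fun a h h' => h' h
    have hae : ∀ᵐ y ∂(Measure.pi fun _ : Fin m => P.toMeasure), ∀ i, y i ∈ P.support := by
      rw [ae_all_iff]
      intro i
      exact (Measure.tendsto_eval_ae_ae (μ := fun _ : Fin m => P.toMeasure) (i := i)).eventually hsupp
    have hm : MeasurableSet {x : Fin m → Ω | Function.Injective x} :=
      (Set.to_countable _).measurableSet
    calc _ ≤ ∫⁻ y, ({x : Fin m → Ω | Function.Injective x}).indicator
            (fun _ => ENNReal.ofReal (1 - (m : ℝ) * r)) y
            ∂(Measure.pi fun _ : Fin m => P.toMeasure) := by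
          apply lintegral_mono_ae
          filter_upwards [hae] with y hy
          by_cases hinj : Function.Injective y
          · simpa [hinj] using step_bound P r hr hatom m y hy hinj
          · simp [hinj]
      _ = ENNReal.ofReal (1 - (m : ℝ) * r) * _ := lintegral_indicator_const hm _
      _ ≤ _ := by
          rw [mul_comm]
          gcongr


/-- **Birthday paradox lower bound (product form).**
If every atom of a probability distribution `P` on a countable set `Ω` has mass at least
`ρ / N`, and `X_1, …, X_M` are i.i.d. samples from `P` with `(M-1)·ρ ≤ N`, then the
probability of at least one collision among the samples is at least
`1 - ∏_{t=1}^{M-1} (1 - tρ/N)`. -/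
theorem birthday_paradox_collision_product_bound
    {Ω : Type*} [Countable Ω] [MeasurableSpace Ω] [MeasurableSingletonClass Ω]
    (P : PMF Ω) (N ρ : ℝ) (hN : 0 < N) (hρ0 : 0 < ρ) (hρ1 : ρ ≤ 1)
    (hatom : ∀ x ∈ P.support, ρ / N ≤ (P x).toReal)
    (M : ℕ) (hM : ((M : ℝ) - 1) * ρ ≤ N) :
    ENNReal.ofReal (1 - ∏ t ∈ Finset.Icc 1 (M - 1), (1 - (t : ℝ) * ρ / N)) ≤
      (MeasureTheory.Measure.pi fun _ : Fin M => P.toMeasure)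
        {x | ∃ i j, i ≠ j ∧ x i = x j} := by
  have hr : 0 ≤ ρ / N := by positivity
  have hb := inj_bound P (ρ / N) hr hatom M
  have hset : {x : Fin M → Ω | ∃ i j, i ≠ j ∧ x i = x j} =
      {x : Fin M → Ω | Function.Injective x}ᶜ := by
    ext x
    simp only [Set.mem_setOf_eq, Set.mem_compl_iff, Function.Injective]
    push Not
    exact ⟨fun ⟨i, j, h, h'⟩ => ⟨i, j, h', h⟩, fun ⟨i, j, h, h'⟩ => ⟨i, j, h', h⟩⟩
  have hnn : ∀ t ∈ Finset.Icc 1 (M - 1), 0 ≤ 1 - (t : ℝ) * ρ / N := by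
    intro t ht
    rw [Finset.mem_Icc] at ht
    have h1 : (t : ℝ) + 1 ≤ M := by
      have : t + 1 ≤ M := by omega
      exact_mod_cast this
    rw [sub_nonneg, div_le_one hN]
    nlinarith
  have hprod : ∏ t ∈ Finset.range M, ENNReal.ofReal (1 - (t : ℝ) * (ρ / N)) =
      ENNReal.ofReal (∏ t ∈ Finset.Icc 1 (M - 1), (1 - (t : ℝ) * ρ / N)) := by
    rw [ENNReal.ofReal_prod_of_nonneg hnn]
    symm
    simp only [mul_div_assoc]
    apply Finset.prod_subset
    · intro t ht
      simp only [Finset.mem_Icc, Finset.mem_range] at *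
      omega
    · intro t ht ht'
      have : t = 0 := by
        simp only [Finset.mem_Icc, Finset.mem_range] at *
        omega
      simp [this]
  rw [hprod] at hb
  rw [hset, MeasureTheory.prob_compl_eq_one_sub (Set.to_countable _).measurableSet,
    ENNReal.ofReal_sub _ (Finset.prod_nonneg hnn), ENNReal.ofReal_one]
  exact tsub_le_tsub_left hb _
end

section
/- Let P be a probability distribution on a countable set Ω, let M ≥ 1 be a real number, let γ ∈ (0, 1), and set β = 1/∑_{x∈Ω} P(x)². Let S ⊆ Ω be a subset of cardinality N ≥ 1 with ∑_{x∈S} P(x) ≥ ρ for some 0 < ρ ≤ 1. Set D = (−3 + √(9 + (24/M)·ln(1/(1−γ)))) − 2M(1−ρ)², and suppose D > 0. Assume (i) exp(−M²/(2β) − M³/(6β²)) ≤ 1 − γ, and (ii) ∑_{x∈Ω} P(x)² ≤ ρ²/N + (1−ρ)². Then N ≤ 2Mρ² / D. -/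
/-- **Theorem 2 of the paper (precise form).**
Let `P` be a probability distribution on a countable set `Ω`, `M ≥ 1` a real number,
`γ ∈ (0,1)`, and `β = 1/∑_{x∈Ω} P(x)²`. If a subset `S ⊆ Ω` of cardinality `N ≥ 1`
carries probability mass at least `ρ` (with `0 < ρ ≤ 1`), and
(i) `exp(-M²/(2β) - M³/(6β²)) ≤ 1 - γ` (Wiener's bound combined with collision
probability `γ`), and (ii) `∑_{x∈Ω} P(x)² ≤ ρ²/N + (1-ρ)²`, then
`N ≤ 2Mρ²/D` where `D = (-3 + √(9 + (24/M)·ln(1/(1-γ)))) - 2M(1-ρ)² > 0`. -/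
theorem support_size_upper_bound_of_collision_prob
    {Ω : Type*} [Countable Ω] (P : PMF Ω)
    (M γ ρ : ℝ) (hM : 1 ≤ M) (hγ0 : 0 < γ) (hγ1 : γ < 1) (hρ0 : 0 < ρ) (hρ1 : ρ ≤ 1)
    (β : ℝ) (hβ : β = 1 / ∑' x : Ω, ((P x).toReal) ^ 2)
    (S : Finset Ω) (N : ℕ) (hN : S.card = N) (hN1 : 1 ≤ N)
    (hmass : ρ ≤ ∑ x ∈ S, (P x).toReal)
    (D : ℝ)
    (hD : D = (-3 + Real.sqrt (9 + (24 / M) * Real.log (1 / (1 - γ)))) - 2 * M * (1 - ρ) ^ 2)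
    (hDpos : 0 < D)
    (hi : Real.exp (-(M ^ 2 / (2 * β)) - M ^ 3 / (6 * β ^ 2)) ≤ 1 - γ)
    (hii : ∑' x : Ω, ((P x).toReal) ^ 2 ≤ ρ ^ 2 / N + (1 - ρ) ^ 2) :
    (N : ℝ) ≤ 2 * M * ρ ^ 2 / D := by
  have hs : 0 ≤ ∑' x : Ω, ((P x).toReal) ^ 2 := tsum_nonneg fun x => sq_nonneg _
  generalize (∑' x : Ω, ((P x).toReal) ^ 2) = s at *
  have hM0 : 0 < M := by linarith
  have hNpos : (0 : ℝ) < N := by exact_mod_cast hN1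
  have e1 : M ^ 2 / (2 * β) = M ^ 2 * s / 2 := by
    rw [hβ, one_div, div_eq_mul_inv, mul_inv, inv_inv]; ring
  have e2 : M ^ 3 / (6 * β ^ 2) = M ^ 3 * s ^ 2 / 6 := by
    rw [hβ, one_div, div_eq_mul_inv, mul_inv, inv_pow, inv_inv]; ring
  rw [e1, e2] at hi
  have h1 := (Real.le_log_iff_exp_le (by linarith)).2 hi
  have hL : Real.log (1 / (1 - γ)) ≤ M ^ 2 * s / 2 + M ^ 3 * s ^ 2 / 6 := by
    rw [one_div, Real.log_inv]; linarith
  have h2 : 9 + (24 / M) * Real.log (1 / (1 - γ)) ≤ (3 + 2 * M * s) ^ 2 := by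
    have h3 := mul_le_mul_of_nonneg_left hL (by positivity : 0 ≤ 24 / M)
    have h4 : 24 / M * (M ^ 2 * s / 2 + M ^ 3 * s ^ 2 / 6) = 12 * M * s + 4 * M ^ 2 * s ^ 2 := by
      field_simp
      ring
    nlinarith
  have h5 : Real.sqrt (9 + (24 / M) * Real.log (1 / (1 - γ))) ≤ 3 + 2 * M * s :=
    Real.sqrt_le_iff.2 ⟨by positivity, h2⟩
  have h6 := mul_le_mul_of_nonneg_left hii (by positivity : 0 ≤ 2 * M)
  have h7 : D ≤ 2 * M * ρ ^ 2 / N := by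
    have : 2 * M * (ρ ^ 2 / N + (1 - ρ) ^ 2) = 2 * M * ρ ^ 2 / N + 2 * M * (1 - ρ) ^ 2 := by ring
    linarith
  rw [le_div_iff₀ hDpos]
  rw [le_div_iff₀ hNpos] at h7
  linarith
end
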